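/- (No nontrivial S-subsolutions below the Hardy constant.) Let μ ≤ 1/4, p > 1 and s ∈ ℝ. Assume the global Hardy inequality with constant μ holds on Ω: ∫_Ω |∇φ(x)|² dx ≥ μ ∫_Ω φ(x)²/δ(x)² dx for every smooth function φ : ℝ^N → ℝ with compact support contained in Ω (i.e. μ ≤ C_H(Ω)). If u is a sub-solution of (*) on all of Ω satisfying lim_{δ(x)→0} u(x)/(δ(x)^{1/2}·(log(1/δ(x)))^{1/2}) = 0 (an S-subsolution), then u ≡ 0 on Ω. -/

import Mathlib

open Set Metric MeasureTheory Real

noncomputable section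

/-- Distance to the boundary of `Ω`. -/
def bdist {N : ℕ} (Ω : Set (EuclideanSpace ℝ (Fin N))) (x : EuclideanSpace ℝ (Fin N)) : ℝ :=
  Metric.infDist x Ωᶜ

/-- The collar `Ω_ρ = {x ∈ Ω : δ(x) < ρ}`. -/
def collar {N : ℕ} (Ω : Set (EuclideanSpace ℝ (Fin N))) (ρ : ℝ) :
    Set (EuclideanSpace ℝ (Fin N)) :=
  {x ∈ Ω | bdist Ω x < ρ}

/-- The ring `Ω_{ε,ρ} = {x ∈ Ω : ε < δ(x) < ρ}`. -/
def ring' {N : ℕ} (Ω : Set (EuclideanSpace ℝ (Fin N))) (ε ρ : ℝ) :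
    Set (EuclideanSpace ℝ (Fin N)) :=
  {x ∈ Ω | ε < bdist Ω x ∧ bdist Ω x < ρ}

/-- The Laplacian. -/
def lap {N : ℕ} (f : EuclideanSpace ℝ (Fin N) → ℝ) (x : EuclideanSpace ℝ (Fin N)) : ℝ :=
  ∑ i : Fin N, fderiv ℝ (fun y => fderiv ℝ f y (EuclideanSpace.single i 1)) x
    (EuclideanSpace.single i 1)

/-- `ρ₀` is a good collar width: `δ` is `C²` on `Ω_{ρ₀}`, `|∇δ| = 1` there, `Δδ` bounded. -/
def GoodCollar {N : ℕ} (Ω : Set (EuclideanSpace ℝ (Fin N))) (ρ₀ : ℝ) : Prop :=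
  0 < ρ₀ ∧ ContDiffOn ℝ 2 (bdist Ω) (collar Ω ρ₀) ∧
    (∀ x ∈ collar Ω ρ₀, ‖gradient (bdist Ω) x‖ = 1) ∧
    ∃ M, ∀ x ∈ collar Ω ρ₀, |lap (bdist Ω) x| ≤ M

/-- A super-harmonic of `L_μ = -Δ - μ/δ²` on `G`. -/
def SuperHarm {N : ℕ} (Ω : Set (EuclideanSpace ℝ (Fin N))) (μ : ℝ)
    (G : Set (EuclideanSpace ℝ (Fin N))) (h : EuclideanSpace ℝ (Fin N) → ℝ) : Prop :=
  ContDiffOn ℝ 2 h G ∧ ∀ x ∈ G, 0 ≤ -(lap h x) - μ / (bdist Ω x) ^ 2 * h x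

/-- A sub-harmonic of `L_μ = -Δ - μ/δ²` on `G`. -/
def SubHarm {N : ℕ} (Ω : Set (EuclideanSpace ℝ (Fin N))) (μ : ℝ)
    (G : Set (EuclideanSpace ℝ (Fin N))) (h : EuclideanSpace ℝ (Fin N) → ℝ) : Prop :=
  ContDiffOn ℝ 2 h G ∧ ∀ x ∈ G, -(lap h x) - μ / (bdist Ω x) ^ 2 * h x ≤ 0

/-- A positive local super-harmonic of `L_μ`, defined on the collar `Ω_σ`. -/
def PosSuperHarmOn {N : ℕ} (Ω : Set (EuclideanSpace ℝ (Fin N))) (μ σ : ℝ)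
    (h : EuclideanSpace ℝ (Fin N) → ℝ) : Prop :=
  SuperHarm Ω μ (collar Ω σ) h ∧ ∀ x ∈ collar Ω σ, 0 < h x

/-- A sub-solution of `(*)`: `-Δu - (μ/δ²)u + u^p/δ^s = 0` on `G`. -/
def SubSol {N : ℕ} (Ω : Set (EuclideanSpace ℝ (Fin N))) (μ s p : ℝ)
    (G : Set (EuclideanSpace ℝ (Fin N))) (u : EuclideanSpace ℝ (Fin N) → ℝ) : Prop :=
  ContDiffOn ℝ 2 u G ∧ (∀ x ∈ G, 0 ≤ u x) ∧
    ∀ x ∈ G, -(lap u x) - μ / (bdist Ω x) ^ 2 * u x + (u x) ^ p / (bdist Ω x) ^ s ≤ 0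

/-- A super-solution of `(*)` on `G`. -/
def SuperSol {N : ℕ} (Ω : Set (EuclideanSpace ℝ (Fin N))) (μ s p : ℝ)
    (G : Set (EuclideanSpace ℝ (Fin N))) (u : EuclideanSpace ℝ (Fin N) → ℝ) : Prop :=
  ContDiffOn ℝ 2 u G ∧ (∀ x ∈ G, 0 < u x) ∧
    ∀ x ∈ G, 0 ≤ -(lap u x) - μ / (bdist Ω x) ^ 2 * u x + (u x) ^ p / (bdist Ω x) ^ s

/-- A regularized distance `(d, c)` on `Ω`. -/
def RegDist {N : ℕ} (Ω : Set (EuclideanSpace ℝ (Fin N))) (d : EuclideanSpace ℝ (Fin N) → ℝ)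
    (c : ℝ) : Prop :=
  1 ≤ c ∧ ContDiffOn ℝ 2 d Ω ∧ (∀ x ∈ Ω, 0 < d x) ∧
    (∀ x ∈ Ω, c⁻¹ * bdist Ω x ≤ d x ∧ d x ≤ c * bdist Ω x) ∧
    (∀ x ∈ Ω, ‖gradient d x‖ ≤ c) ∧ (∀ x ∈ Ω, |lap d x| ≤ c / d x)

open Filter Topology in
/-- One-dimensional logarithmic cut-off. -/
lemma cutoff_exists (ρ κ : ℝ) (hρ : 0 < ρ) (hκ : 0 < κ) :
    ∃ θ : ℝ → ℝ, ∃ a : ℝ, 0 < a ∧ ContDiff ℝ 1 θ ∧ (∀ r ≤ a, θ r = 0) ∧ (∀ r, ρ ≤ r → θ r = 1) ∧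
      (∀ r, 0 ≤ θ r ∧ θ r ≤ 1) ∧ (∀ r, 0 ≤ deriv θ r) ∧
      ∀ r, 0 < r → r < 1 → r * Real.log (1 / r) * deriv θ r ^ 2 ≤ κ * deriv θ r := by
  obtain ⟨K, hK⟩ : ∃ K, ∀ x, deriv Real.smoothTransition x ≤ K := by
    have hc : Continuous (deriv Real.smoothTransition) :=
      (Real.smoothTransition.contDiff (n := 1)).continuous_deriv le_rfl
    obtain ⟨K, hK⟩ := (isCompact_Icc (a := (0:ℝ)) (b := 1)).bddAbove_image hc.continuousOn
    refine ⟨max K 0, fun x => ?_⟩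
    by_cases hx : x ∈ Icc (0:ℝ) 1
    · exact le_max_of_le_left (hK ⟨x, hx, rfl⟩)
    · have : deriv Real.smoothTransition x = 0 := by
        rcases lt_or_ge x 0 with h | h
        · have : Real.smoothTransition =ᶠ[𝓝 x] fun _ => 0 := by
            filter_upwards [Iio_mem_nhds h] with y hy
            exact Real.smoothTransition.zero_of_nonpos (le_of_lt hy)
          rw [this.deriv_eq]; simp
        · have h1 : 1 < x := by
            by_contra h1; exact hx ⟨h, not_lt.1 h1⟩
          have : Real.smoothTransition =ᶠ[𝓝 x] fun _ => 1 := by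
            filter_upwards [Ioi_mem_nhds h1] with y hy
            exact Real.smoothTransition.one_of_one_le (le_of_lt hy)
          rw [this.deriv_eq]; simp
      rw [this]; exact le_max_right _ _
  -- choose T
  set T : ℝ := max 1 (max (K / κ) (Real.log (1 + |Real.log ρ|))) with hT
  have hT0 : 0 < T := lt_of_lt_of_le one_pos (le_max_left _ _)
  have hKT : K / T ≤ κ := by
    have : K / κ ≤ T := (le_max_left _ _).trans (le_max_right _ _)
    rw [div_le_iff₀ hκ] at this
    rw [div_le_iff₀ hT0]; linarith
  have hρT : Real.exp (-Real.exp T) ≤ ρ := by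
    have h1 : Real.log (1 + |Real.log ρ|) ≤ T := (le_max_right _ _).trans (le_max_right _ _)
    have h2 : 1 + |Real.log ρ| ≤ Real.exp T := by
      rw [← Real.log_le_iff_le_exp (by positivity)]; exact h1
    rw [← Real.le_log_iff_exp_le hρ]
    have := neg_abs_le (Real.log ρ)
    linarith
  set θ : ℝ → ℝ := fun r => if r ≤ 0 then 0 else if r < 1 then
    Real.smoothTransition (2 - Real.log (-Real.log r) / T) else 1 with hθ
  have hL : ∀ r, 0 < r → r < 1 → 0 < -Real.log r := fun r h0 h1 => by
    have := Real.log_neg h0 h1; linarith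
  have hθmid : ∀ r, 0 < r → r < 1 →
      θ r = Real.smoothTransition (2 - Real.log (-Real.log r) / T) := fun r h0 h1 => by
    simp [hθ, not_le.2 h0, h1]
  have hθ0 : ∀ r ≤ Real.exp (-Real.exp (2 * T)), θ r = 0 := by
    intro r hr
    rcases le_or_gt r 0 with h0 | h0
    · simp [hθ, h0]
    · have h1 : r < 1 := lt_of_le_of_lt hr (by rw [Real.exp_lt_one_iff]; simp [Real.exp_pos])
      rw [hθmid r h0 h1]
      apply Real.smoothTransition.zero_of_nonpos
      have h2 : Real.exp (2 * T) ≤ -Real.log r := by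
        have := (Real.log_le_iff_le_exp h0).2 hr; linarith
      have h3 : 2 * T ≤ Real.log (-Real.log r) := (Real.le_log_iff_exp_le (hL r h0 h1)).2 h2
      have : 2 ≤ Real.log (-Real.log r) / T := by rw [le_div_iff₀ hT0]; exact h3
      linarith
  have hθ1 : ∀ r, Real.exp (-Real.exp T) ≤ r → θ r = 1 := by
    intro r hr
    have h0 : 0 < r := lt_of_lt_of_le (Real.exp_pos _) hr
    rcases lt_or_ge r 1 with h1 | h1
    · rw [hθmid r h0 h1]
      apply Real.smoothTransition.one_of_one_le
      have h2 : -Real.log r ≤ Real.exp T := by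
        have := (Real.le_log_iff_exp_le h0).2 hr; linarith
      have h3 : Real.log (-Real.log r) ≤ T := (Real.log_le_iff_le_exp (hL r h0 h1)).2 h2
      have : Real.log (-Real.log r) / T ≤ 1 := by rw [div_le_iff₀ hT0]; linarith
      linarith
    · simp [hθ, not_le.2 h0, not_lt.2 h1]
  have hmid_ev : ∀ r, 0 < r → r < 1 →
      θ =ᶠ[𝓝 r] fun r => Real.smoothTransition (2 - Real.log (-Real.log r) / T) := by
    intro r h0 h1
    filter_upwards [Ioo_mem_nhds h0 h1] with y hy using hθmid y hy.1 hy.2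
  have hlow_ev : ∀ r ≤ 0, θ =ᶠ[𝓝 r] fun _ => 0 := by
    intro r h0
    filter_upwards [Iio_mem_nhds (lt_of_le_of_lt h0 (Real.exp_pos (-Real.exp (2 * T))))] with y hy
    exact hθ0 y (le_of_lt hy)
  have hhigh_ev : ∀ r, 1 ≤ r → θ =ᶠ[𝓝 r] fun _ => 1 := by
    intro r h0
    have : Real.exp (-Real.exp T) < r := 
      lt_of_lt_of_le (by rw [Real.exp_lt_one_iff]; simp [Real.exp_pos]) h0
    filter_upwards [Ioi_mem_nhds this] with y hy
    exact hθ1 y (le_of_lt hy)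
  have hder : ∀ r, 0 < r → r < 1 → deriv θ r =
      deriv Real.smoothTransition (2 - Real.log (-Real.log r) / T) * (1 / (T * r * (-Real.log r))) := by
    intro r h0 h1
    rw [(hmid_ev r h0 h1).deriv_eq]
    have hS : HasDerivAt Real.smoothTransition
        (deriv Real.smoothTransition (2 - Real.log (-Real.log r) / T))
        (2 - Real.log (-Real.log r) / T) :=
      ((Real.smoothTransition.contDiff (n := 1)).differentiable (by simp)).differentiableAt.hasDerivAt
    have hl : HasDerivAt (fun r => 2 - Real.log (-Real.log r) / T)
        (-((-r⁻¹ / (-Real.log r)) / T)) r :=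
      ((((Real.hasDerivAt_log h0.ne').neg).log (hL r h0 h1).ne').div_const T).const_sub 2
    have := (hS.comp r hl).deriv
    rw [show (Real.smoothTransition ∘ fun r => 2 - Real.log (-Real.log r) / T) = 
      fun r => Real.smoothTransition (2 - Real.log (-Real.log r) / T) from rfl] at this
    rw [this]
    have := hL r h0 h1
    have hl0 : Real.log r ≠ 0 := by intro h'; rw [h'] at this; simp at this
    field_simp
  have hSd : ∀ x, 0 ≤ deriv Real.smoothTransition x := fun x =>
    Real.smoothTransition.monotone.deriv_nonneg
  have hdn : ∀ r, 0 ≤ deriv θ r := by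
    intro r
    rcases le_or_gt r 0 with h0 | h0
    · rw [(hlow_ev r h0).deriv_eq]; simp
    rcases lt_or_ge r 1 with h1 | h1
    · rw [hder r h0 h1]
      have := hL r h0 h1
      have := hSd (2 - Real.log (-Real.log r) / T)
      positivity
    · rw [(hhigh_ev r h1).deriv_eq]; simp
  refine ⟨θ, Real.exp (-Real.exp (2 * T)), Real.exp_pos _, ?_, hθ0,
    fun r hr => hθ1 r (hρT.trans hr), ?_, hdn, ?_⟩
  · rw [contDiff_iff_contDiffAt]
    intro r
    rcases le_or_gt r 0 with h0 | h0
    · exact contDiffAt_const.congr_of_eventuallyEq (hlow_ev r h0)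
    rcases lt_or_ge r 1 with h1 | h1
    · refine ContDiffAt.congr_of_eventuallyEq ?_ (hmid_ev r h0 h1)
      have h2 := hL r h0 h1
      refine (Real.smoothTransition.contDiff (n := 1)).contDiffAt.comp r ?_
      exact contDiffAt_const.sub (((Real.contDiffAt_log.2 h0.ne').neg.log h2.ne').div_const T)
    · exact contDiffAt_const.congr_of_eventuallyEq (hhigh_ev r h1)
  · intro r
    simp only [hθ]
    split_ifs
    · simp
    · exact ⟨Real.smoothTransition.nonneg _, Real.smoothTransition.le_one _⟩
    · simp
  · intro r h0 h1
    have h2 := hL r h0 h1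
    have h3 : r * Real.log (1 / r) * deriv θ r ≤ κ := by
      rw [hder r h0 h1, one_div, Real.log_inv]
      refine le_trans (le_of_eq ?_) ((div_le_div_of_nonneg_right
        (hK (2 - Real.log (-Real.log r) / T)) hT0.le).trans hKT)
      have hl0 : Real.log r ≠ 0 := by intro h'; rw [h'] at h2; simp at h2
      field_simp
    calc _ = (r * Real.log (1 / r) * deriv θ r) * deriv θ r := by ring
      _ ≤ _ := mul_le_mul_of_nonneg_right h3 (hdn r)

/-- Integral of a derivative of a compactly supported `C¹` function vanishes. -/
lemma integral_fderiv_zero {N : ℕ} (w : EuclideanSpace ℝ (Fin N) → ℝ) (hw : ContDiff ℝ 1 w)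
    (hc : HasCompactSupport w) (v : EuclideanSpace ℝ (Fin N)) :
    ∫ x, fderiv ℝ w x v = 0 := by
  have hcont : Continuous fun x => fderiv ℝ w x v :=
    (hw.continuous_fderiv (by simp)).clm_apply continuous_const
  have hcs : HasCompactSupport fun x => fderiv ℝ w x v := hc.fderiv_apply ℝ v
  have := integral_mul_fderiv_eq_neg_fderiv_mul_of_integrable (𝕜 := ℝ) (μ := volume) (f := w)
    (g := fun _ => (1:ℝ)) (v := v)
    (by simpa using hcont.integrable_of_hasCompactSupport hcs)
    (by simp) (by simpa using hw.continuous.integrable_of_hasCompactSupport hc)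
    (fun x _ => (hw.differentiable (by simp)).differentiableAt)
    (fun x _ => differentiableAt_const _)
  simpa using this

lemma norm_gradient_eq {N : ℕ} (f : EuclideanSpace ℝ (Fin N) → ℝ) (x : EuclideanSpace ℝ (Fin N)) :
    ‖gradient f x‖ = ‖fderiv ℝ f x‖ := by
  rw [gradient, LinearIsometryEquiv.norm_map]

lemma norm_gradient_sq {N : ℕ} (f : EuclideanSpace ℝ (Fin N) → ℝ)
    (x : EuclideanSpace ℝ (Fin N)) :
    ‖gradient f x‖ ^ 2 = ∑ i, (fderiv ℝ f x (EuclideanSpace.single i 1)) ^ 2 := by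
  rw [EuclideanSpace.norm_sq_eq]
  refine Finset.sum_congr rfl fun i _ => ?_
  have h : fderiv ℝ f x (EuclideanSpace.single i 1) =
      inner ℝ (gradient f x) (EuclideanSpace.single i 1) := by
    rw [← InnerProductSpace.toDual_apply_apply, toDual_gradient]
  rw [Real.norm_eq_abs, sq_abs, h, EuclideanSpace.inner_single_right]
  simp

lemma bdist_continuous {N : ℕ} (Ω : Set (EuclideanSpace ℝ (Fin N))) : Continuous (bdist Ω) :=
  Metric.continuous_infDist_pt _

lemma mem_of_bdist_pos {N : ℕ} {Ω : Set (EuclideanSpace ℝ (Fin N))} {x : EuclideanSpace ℝ (Fin N)}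
    (h : 0 < bdist Ω x) : x ∈ Ω := by
  by_contra hx
  have : bdist Ω x = 0 := Metric.infDist_zero_of_mem hx
  linarith

lemma bdist_pos {N : ℕ} (hN : 2 ≤ N) {Ω : Set (EuclideanSpace ℝ (Fin N))}
    (hΩo : IsOpen Ω) (hΩb : Bornology.IsBounded Ω) {x : EuclideanSpace ℝ (Fin N)}
    (hx : x ∈ Ω) : 0 < bdist Ω x := by
  have hne : (Ωᶜ).Nonempty := by
    rw [Set.nonempty_compl]
    rintro rfl
    have : Nonempty (Fin N) := ⟨⟨0, by omega⟩⟩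
    exact NormedSpace.unbounded_univ ℝ (EuclideanSpace ℝ (Fin N)) hΩb
  exact (hΩo.isClosed_compl.notMem_iff_infDist_pos hne).1 (by simpa using hx)

lemma isCompact_bdist_ge {N : ℕ} {Ω : Set (EuclideanSpace ℝ (Fin N))}
    (hΩb : Bornology.IsBounded Ω) {a : ℝ} (ha : 0 < a) : IsCompact {x | a ≤ bdist Ω x} :=
  Metric.isCompact_of_isClosed_isBounded (isClosed_le continuous_const (bdist_continuous Ω))
    (hΩb.subset fun _ hx => mem_of_bdist_pos (lt_of_lt_of_le ha hx))

lemma contDiff_of_tsupp {N : ℕ} {F : Type*} [NormedAddCommGroup F] [NormedSpace ℝ F]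
    {w : EuclideanSpace ℝ (Fin N) → F} {n : WithTop ℕ∞}
    (h : ∀ x ∈ tsupport w, ContDiffAt ℝ n w x) : ContDiff ℝ n w := by
  rw [contDiff_iff_contDiffAt]
  intro x
  by_cases hx : x ∈ tsupport w
  · exact h x hx
  · exact contDiffAt_const.congr_of_eventuallyEq (notMem_tsupport_iff_eventuallyEq.1 hx)

open Filter Topology in
/-- Hardy inequality for `C¹` functions. -/
lemma hardy_C1 {N : ℕ} (hN : 2 ≤ N) (Ω : Set (EuclideanSpace ℝ (Fin N)))
    (hΩo : IsOpen Ω) (hΩb : Bornology.IsBounded Ω) (μ : ℝ)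
    (hHardy : ∀ φ : EuclideanSpace ℝ (Fin N) → ℝ, ContDiff ℝ (⊤ : ℕ∞) φ →
      HasCompactSupport φ → tsupport φ ⊆ Ω →
      μ * ∫ x in Ω, (φ x) ^ 2 / (bdist Ω x) ^ 2 ≤ ∫ x in Ω, ‖gradient φ x‖ ^ 2)
    (φ : EuclideanSpace ℝ (Fin N) → ℝ) (hφ : ContDiff ℝ 1 φ) (hc : HasCompactSupport φ)
    (hs : tsupport φ ⊆ Ω) :
    μ * ∫ x in Ω, (φ x) ^ 2 / (bdist Ω x) ^ 2 ≤ ∫ x in Ω, ‖gradient φ x‖ ^ 2 := by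
  obtain ⟨r, hr, hrΩ⟩ := hc.isCompact.exists_cthickening_subset_open hΩo hs
  set K := cthickening r (tsupport φ) with hKdef
  have hK : IsCompact K := hc.isCompact.cthickening
  let b : ℕ → ContDiffBump (0 : EuclideanSpace ℝ (Fin N)) := fun n =>
    ⟨r / (n + 1) / 2, r / (n + 1), by positivity, half_lt_self (by positivity)⟩
  have hbr : ∀ n, (b n).rOut = r / (n + 1) := fun n => rfl
  have hbr' : ∀ n, (b n).rOut ≤ r := fun n => by
    rw [hbr]; exact div_le_self hr.le (by linarith [Nat.cast_nonneg (α := ℝ) n])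
  have hbt : Tendsto (fun n => (b n).rOut) atTop (𝓝 0) := by
    simp_rw [hbr]
    exact tendsto_const_div_atTop_nhds_zero_nat r |>.comp (tendsto_add_atTop_nat 1) |>.congr
      (fun n => by simp)
  let ψ : ℕ → EuclideanSpace ℝ (Fin N) → ℝ := fun n =>
    convolution ((b n).normed volume) φ (ContinuousLinearMap.lsmul ℝ ℝ) volume
  let ψ' : ℕ → EuclideanSpace ℝ (Fin N) → (EuclideanSpace ℝ (Fin N) →L[ℝ] ℝ) := fun n =>
    convolution ((b n).normed volume) (fderiv ℝ φ) (ContinuousLinearMap.lsmul ℝ ℝ) volume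
  have hcont' : Continuous (fderiv ℝ φ) := hφ.continuous_fderiv (by simp)
  have hψd : ∀ n x, fderiv ℝ (ψ n) x = ψ' n x := by
    intro n x
    have h := hc.hasFDerivAt_convolution_right (ContinuousLinearMap.lsmul ℝ ℝ) (μ := volume)
      (f := (b n).normed volume)
      ((b n).contDiff_normed (n := 0)).continuous.locallyIntegrable hφ x
    rw [h.fderiv]
    simp only [ψ', convolution]
    rfl
  have hψsm : ∀ n, ContDiff ℝ (⊤ : ℕ∞) (ψ n) := fun n =>
    (b n).hasCompactSupport_normed.contDiff_convolution_left _ (b n).contDiff_normed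
      hφ.continuous.locallyIntegrable
  have hz : ∀ x ∉ K, ∀ y ∈ ball x r, y ∉ tsupport φ := by
    intro x hx y hy hyt
    apply hx
    exact mem_cthickening_of_dist_le x y r _ hyt (by rw [dist_comm]; exact (mem_ball.1 hy).le)
  have hz0 : ∀ n, ∀ x ∉ K, ψ n x = 0 := by
    intro n x hx
    have h0 : ∀ y ∈ ball x r, φ y = 0 := fun y hy => image_eq_zero_of_notMem_tsupport (hz x hx y hy)
    have := (b n).normed_convolution_eq_right (μ := volume) (g := φ) (x₀ := x) (fun y hy => by
      rw [h0 y (ball_subset_ball (hbr' n) hy), h0 x (mem_ball_self hr)])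
    rw [h0 x (mem_ball_self hr)] at this
    exact this
  have hz1 : ∀ n, ∀ x ∉ K, ψ' n x = 0 := by
    intro n x hx
    have h0 : ∀ y ∈ ball x r, fderiv ℝ φ y = 0 := fun y hy =>
      image_eq_zero_of_notMem_tsupport (fun h => hz x hx y hy (tsupport_fderiv_subset ℝ h))
    have := (b n).normed_convolution_eq_right (μ := volume) (g := fderiv ℝ φ) (x₀ := x)
      (fun y hy => by
      rw [h0 y (ball_subset_ball (hbr' n) hy), h0 x (mem_ball_self hr)])
    rw [h0 x (mem_ball_self hr)] at this
    exact this
  have hsuppψ : ∀ n, tsupport (ψ n) ⊆ K := fun n =>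
    closure_minimal (fun x hx => by by_contra h; exact hx (hz0 n x h)) isClosed_cthickening
  have hlim0 : ∀ x, Tendsto (fun n => ψ n x) atTop (𝓝 (φ x)) := fun x =>
    ContDiffBump.convolution_tendsto_right_of_continuous hbt hφ.continuous x
  have hlim1 : ∀ x, Tendsto (fun n => ψ' n x) atTop (𝓝 (fderiv ℝ φ x)) := fun x =>
    ContDiffBump.convolution_tendsto_right_of_continuous hbt hcont' x
  obtain ⟨B, hB⟩ := hφ.continuous.bounded_above_of_compact_support hc
  obtain ⟨B', hB'⟩ := hcont'.bounded_above_of_compact_support (hc.fderiv ℝ)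
  have hb0 : ∀ n x, ‖ψ n x‖ ≤ 3 * B := by
    intro n x
    have : dist (ψ n x) (φ x) ≤ 2 * B :=
      (b n).dist_normed_convolution_le hφ.continuous.aestronglyMeasurable (fun y _ => by
        rw [dist_eq_norm]; linarith [norm_sub_le (φ y) (φ x), hB x, hB y])
    rw [dist_eq_norm] at this
    have h2 := norm_add_le (ψ n x - φ x) (φ x)
    rw [sub_add_cancel] at h2
    linarith [hB x]
  have hb1 : ∀ n x, ‖ψ' n x‖ ≤ 3 * B' := by
    intro n x
    have : dist (ψ' n x) (fderiv ℝ φ x) ≤ 2 * B' :=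
      (b n).dist_normed_convolution_le hcont'.aestronglyMeasurable (fun y _ => by
        rw [dist_eq_norm]; linarith [norm_sub_le (fderiv ℝ φ y) (fderiv ℝ φ x), hB' x, hB' y])
    rw [dist_eq_norm] at this
    have h2 := norm_add_le (ψ' n x - fderiv ℝ φ x) (fderiv ℝ φ x)
    rw [sub_add_cancel] at h2
    linarith [hB' x]
  have hH : ∀ n, μ * ∫ x in Ω, (ψ n x) ^ 2 / (bdist Ω x) ^ 2 ≤ ∫ x in Ω, ‖ψ' n x‖ ^ 2 := by
    intro n
    have := hHardy (ψ n) (hψsm n) (hK.of_isClosed_subset (isClosed_tsupport _) (hsuppψ n))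
      ((hsuppψ n).trans hrΩ)
    simpa only [norm_gradient_eq, hψd] using this
  have hδK : ContinuousOn (fun x => (3 * B) ^ 2 / (bdist Ω x) ^ 2) K :=
    continuousOn_const.div ((bdist_continuous Ω).pow 2).continuousOn
      (fun x hx => (pow_pos (bdist_pos hN hΩo hΩb (hrΩ hx)) 2).ne')
  have hmeasψ' : ∀ n, Continuous (ψ' n) := fun n => by
    have : ψ' n = fderiv ℝ (ψ n) := by ext1 x; rw [hψd]
    rw [this]; exact (hψsm n).continuous_fderiv (by simp)
  have hT0 : Tendsto (fun n => ∫ x in Ω, (ψ n x) ^ 2 / (bdist Ω x) ^ 2) atTop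
      (𝓝 (∫ x in Ω, (φ x) ^ 2 / (bdist Ω x) ^ 2)) := by
    refine tendsto_integral_of_dominated_convergence
      (K.indicator fun x => (3 * B) ^ 2 / (bdist Ω x) ^ 2) ?_ ?_ ?_ ?_
    · intro n
      exact (((hψsm n).continuous.pow 2).measurable.div
        ((bdist_continuous Ω).pow 2).measurable).aestronglyMeasurable
    · exact ((integrable_indicator_iff hK.measurableSet).2
        (hδK.integrableOn_compact hK)).integrableOn
    · intro n
      refine Eventually.of_forall fun x => ?_
      by_cases hx : x ∈ K
      · rw [indicator_of_mem hx, norm_div, norm_pow, Real.norm_of_nonneg (sq_nonneg (bdist Ω x))]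
        gcongr
        exact hb0 n x
      · rw [indicator_of_notMem hx, hz0 n x hx]; simp
    · exact Eventually.of_forall fun x => ((hlim0 x).pow 2).div_const _
  have hT1 : Tendsto (fun n => ∫ x in Ω, ‖ψ' n x‖ ^ 2) atTop
      (𝓝 (∫ x in Ω, ‖fderiv ℝ φ x‖ ^ 2)) := by
    refine tendsto_integral_of_dominated_convergence
      (K.indicator fun x => (3 * B') ^ 2) ?_ ?_ ?_ ?_
    · intro n
      exact ((hmeasψ' n).norm.pow 2).aestronglyMeasurable
    · exact ((integrable_indicator_iff hK.measurableSet).2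
        (continuousOn_const.integrableOn_compact hK)).integrableOn
    · intro n
      refine Eventually.of_forall fun x => ?_
      by_cases hx : x ∈ K
      · rw [indicator_of_mem hx, norm_pow, norm_norm]
        gcongr
        exact hb1 n x
      · rw [indicator_of_notMem hx, hz1 n x hx]; simp
    · exact Eventually.of_forall fun x => ((hlim1 x).norm.pow 2)
  simp only [norm_gradient_eq]
  exact le_of_tendsto_of_tendsto' (hT0.const_mul μ) hT1 hH

lemma integrable_mul_of_tsupport {N : ℕ} {Ω : Set (EuclideanSpace ℝ (Fin N))} (hΩo : IsOpen Ω)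
    {η g : EuclideanSpace ℝ (Fin N) → ℝ} (hη : Continuous η) (hc : HasCompactSupport η)
    (hs : tsupport η ⊆ Ω) (hg : ContinuousOn g Ω) : Integrable (fun x => η x * g x) := by
  refine Continuous.integrable_of_hasCompactSupport ?_ (hc.mul_right (f' := g))
  refine continuous_of_tsupport fun x hx => ?_
  have hx' : x ∈ Ω := hs (tsupport_mul_subset_left (f := η) (g := g) hx)
  exact hη.continuousAt.mul (hg.continuousAt (hΩo.mem_nhds hx'))

lemma fderiv_pd_contDiffOn {N : ℕ} {Ω : Set (EuclideanSpace ℝ (Fin N))} (hΩo : IsOpen Ω)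
    {u : EuclideanSpace ℝ (Fin N) → ℝ} (hu : ContDiffOn ℝ 2 u Ω) (v : EuclideanSpace ℝ (Fin N)) :
    ContDiffOn ℝ 1 (fun y => fderiv ℝ u y v) Ω :=
  (hu.fderiv_of_isOpen hΩo (m := 1) (by norm_num)).clm_apply contDiffOn_const

lemma tsupport_fderiv_sq {N : ℕ} (f : EuclideanSpace ℝ (Fin N) → ℝ) :
    tsupport (fun x => ‖fderiv ℝ f x‖ ^ 2) ⊆ tsupport f := by
  refine subset_trans (closure_mono ?_) (tsupport_fderiv_subset ℝ (f := f))
  intro x hx h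
  apply hx
  simp [h]

lemma compactSupport_fderiv_sq {N : ℕ} {f : EuclideanSpace ℝ (Fin N) → ℝ}
    (hf : HasCompactSupport f) : HasCompactSupport (fun x => ‖fderiv ℝ f x‖ ^ 2) :=
  hf.mono' ((subset_tsupport _).trans (tsupport_fderiv_sq f))

/-- Energy inequality. -/
lemma energy {N : ℕ} (hN : 2 ≤ N) (Ω : Set (EuclideanSpace ℝ (Fin N)))
    (hΩo : IsOpen Ω) (hΩb : Bornology.IsBounded Ω) (μ s p : ℝ) (hp : 1 < p)
    (hHardy : ∀ φ : EuclideanSpace ℝ (Fin N) → ℝ, ContDiff ℝ (⊤ : ℕ∞) φ →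
      HasCompactSupport φ → tsupport φ ⊆ Ω →
      μ * ∫ x in Ω, (φ x) ^ 2 / (bdist Ω x) ^ 2 ≤ ∫ x in Ω, ‖gradient φ x‖ ^ 2)
    (u : EuclideanSpace ℝ (Fin N) → ℝ) (hu : SubSol Ω μ s p Ω u)
    (η : EuclideanSpace ℝ (Fin N) → ℝ) (hη : ContDiff ℝ 1 η) (hc : HasCompactSupport η)
    (hs : tsupport η ⊆ Ω) :
    Integrable (fun x => (η x) ^ 2 * (u x * ((u x) ^ p / (bdist Ω x) ^ s))) ∧
    Integrable (fun x => ‖gradient η x‖ ^ 2 * (u x) ^ 2) ∧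
    ∫ x in Ω, (η x) ^ 2 * (u x * ((u x) ^ p / (bdist Ω x) ^ s)) ≤
      ∫ x in Ω, ‖gradient η x‖ ^ 2 * (u x) ^ 2 := by
  obtain ⟨hu2, hu0, hsub⟩ := hu
  have hδ : ∀ x ∈ Ω, 0 < bdist Ω x := fun x hx => bdist_pos hN hΩo hΩb hx
  have huc : ContinuousOn u Ω := hu2.continuousOn
  have hδc : ContinuousOn (bdist Ω) Ω := (bdist_continuous Ω).continuousOn
  have hη2c : HasCompactSupport fun x => (η x) ^ 2 :=
    hc.comp_left (g := fun t : ℝ => t ^ 2) (by simp)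
  have hη2s : tsupport (fun x => (η x) ^ 2) ⊆ Ω := by
    refine subset_trans (closure_mono ?_) hs
    intro x hx h; apply hx; simp [h]
  have hη2 : Continuous fun x => (η x) ^ 2 := hη.continuous.pow 2
  have hfdη : Continuous (fderiv ℝ η) := hη.continuous_fderiv (by simp)
  -- integrability
  have I1 : Integrable (fun x => (η x) ^ 2 * (u x * ((u x) ^ p / (bdist Ω x) ^ s))) := by
    refine integrable_mul_of_tsupport hΩo hη2 hη2c hη2s ?_
    refine huc.mul ((huc.rpow_const fun x _ => Or.inr (by linarith)).div
      (hδc.rpow_const fun x hx => Or.inl (hδ x hx).ne') fun x hx =>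
        (Real.rpow_pos_of_pos (hδ x hx) s).ne')
  have I2 : Integrable (fun x => ‖gradient η x‖ ^ 2 * (u x) ^ 2) := by
    simp only [norm_gradient_eq]
    refine integrable_mul_of_tsupport (η := fun x => ‖fderiv ℝ η x‖ ^ 2) hΩo
      (hfdη.norm.pow 2) ?_ ?_ (huc.pow 2)
    · exact compactSupport_fderiv_sq hc
    · exact (tsupport_fderiv_sq η).trans hs
  refine ⟨I1, I2, ?_⟩
  set φ : EuclideanSpace ℝ (Fin N) → ℝ := fun x => η x * u x with hφdef
  have hφs : tsupport φ ⊆ tsupport η := tsupport_mul_subset_left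
  have hφC : ContDiff ℝ 1 φ := contDiff_of_tsupp fun x hx =>
    hη.contDiffAt.mul ((hu2.contDiffAt (hΩo.mem_nhds (hs (hφs hx)))).of_le (by norm_num))
  have hφc : HasCompactSupport φ := hc.mul_right
  have hH := hardy_C1 hN Ω hΩo hΩb μ hHardy φ hφC hφc (hφs.trans hs)
  have I3 : Integrable (fun x => ‖gradient φ x‖ ^ 2) := by
    simp only [norm_gradient_eq]
    exact ((hφC.continuous_fderiv (by simp)).norm.pow 2).integrable_of_hasCompactSupport
      (compactSupport_fderiv_sq hφc)
  have I4 : Integrable (fun x => φ x ^ 2 / (bdist Ω x) ^ 2) := by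
    have : (fun x => φ x ^ 2 / (bdist Ω x) ^ 2) =
        fun x => (η x) ^ 2 * ((u x) ^ 2 / (bdist Ω x) ^ 2) := by
      ext x; simp only [hφdef]; ring
    rw [this]
    exact integrable_mul_of_tsupport hΩo hη2 hη2c hη2s
      ((huc.pow 2).div (hδc.pow 2) fun x hx => (pow_pos (hδ x hx) 2).ne')
  let e : Fin N → EuclideanSpace ℝ (Fin N) := fun i => EuclideanSpace.single i 1
  let V : Fin N → EuclideanSpace ℝ (Fin N) → ℝ := fun i x => (η x) ^ 2 * (u x * fderiv ℝ u x (e i))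
  have hVs : ∀ i, tsupport (V i) ⊆ Ω := fun i => (tsupport_mul_subset_left).trans hη2s
  have hpd : ∀ i, ContDiffOn ℝ 1 (fun y => fderiv ℝ u y (e i)) Ω := fun i =>
    fderiv_pd_contDiffOn hΩo hu2 (e i)
  have hVC : ∀ i, ContDiff ℝ 1 (V i) := fun i => contDiff_of_tsupp fun x hx => by
    have hx' := hΩo.mem_nhds (hVs i hx)
    exact (hη.contDiffAt.pow 2).mul (((hu2.contDiffAt hx').of_le (by norm_num)).mul
      ((hpd i).contDiffAt hx'))
  have hVc : ∀ i, HasCompactSupport (V i) := fun i => hη2c.mul_right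
  have IV : ∀ i, Integrable (fun x => fderiv ℝ (V i) x (e i)) := fun i =>
    (((hVC i).continuous_fderiv (by simp)).clm_apply continuous_const).integrable_of_hasCompactSupport
      ((hVc i).fderiv_apply ℝ (e i))
  have I5 : Integrable (fun x => ∑ i, fderiv ℝ (V i) x (e i)) := integrable_finsetSum _ fun i _ => IV i
  have hdiv : ∫ x in Ω, ∑ i, fderiv ℝ (V i) x (e i) = 0 := by
    rw [setIntegral_eq_integral_of_forall_compl_eq_zero, integral_finsetSum _ fun i _ => IV i]
    · exact Finset.sum_eq_zero fun i _ => integral_fderiv_zero (V i) (hVC i) (hVc i) (e i)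
    · intro x hx
      refine Finset.sum_eq_zero fun i _ => ?_
      have : fderiv ℝ (V i) x = 0 := image_eq_zero_of_notMem_tsupport
        (fun h => hx (hVs i (tsupport_fderiv_subset ℝ h)))
      simp [this]
  -- pointwise inequality
  have hpt : ∀ x ∈ Ω, ‖gradient φ x‖ ^ 2 ≤ ‖gradient η x‖ ^ 2 * (u x) ^ 2
      + (∑ i, fderiv ℝ (V i) x (e i)) + μ * (φ x ^ 2 / (bdist Ω x) ^ 2)
      - (η x) ^ 2 * (u x * ((u x) ^ p / (bdist Ω x) ^ s)) := by
    intro x hx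
    have hxn := hΩo.mem_nhds hx
    have du : HasFDerivAt u (fderiv ℝ u x) x :=
      ((hu2.contDiffAt hxn).differentiableAt (by norm_num)).hasFDerivAt
    have dη : HasFDerivAt η (fderiv ℝ η x) x :=
      (hη.differentiable (by simp)).differentiableAt.hasFDerivAt
    have dφ : ∀ i, fderiv ℝ φ x (e i) = η x * fderiv ℝ u x (e i) + u x * fderiv ℝ η x (e i) := by
      intro i
      rw [show fderiv ℝ φ x = _ from (dη.mul du).fderiv]
      simp
    have dV : ∀ i, fderiv ℝ (V i) x (e i) = (η x) ^ 2 * (u x *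
        fderiv ℝ (fun y => fderiv ℝ u y (e i)) x (e i) + fderiv ℝ u x (e i) * fderiv ℝ u x (e i))
        + (u x * fderiv ℝ u x (e i)) * (2 * η x * fderiv ℝ η x (e i)) := by
      intro i
      have d2 : HasFDerivAt (fun y => fderiv ℝ u y (e i))
          (fderiv ℝ (fun y => fderiv ℝ u y (e i)) x) x :=
        (((hpd i).contDiffAt hxn).differentiableAt (by norm_num)).hasFDerivAt
      have := ((dη.pow 2).mul (du.mul d2)).fderiv
      rw [show fderiv ℝ (V i) x = _ from this]
      simp
      ring
    have hid : ‖gradient φ x‖ ^ 2 = ‖gradient η x‖ ^ 2 * (u x) ^ 2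
        + (∑ i, fderiv ℝ (V i) x (e i)) - (η x) ^ 2 * u x * lap u x := by
      rw [norm_gradient_sq, norm_gradient_sq, lap, Finset.sum_mul, Finset.mul_sum,
        ← Finset.sum_add_distrib, ← Finset.sum_sub_distrib]
      refine Finset.sum_congr rfl fun i _ => ?_
      have h1 := dφ i
      have h2 := dV i
      simp only [e] at h1 h2
      simp only [e]
      rw [h1, h2]; ring
    rw [hid]
    have h3 := mul_le_mul_of_nonneg_left (hsub x hx) (mul_nonneg (sq_nonneg (η x)) (hu0 x hx))
    have h4 : μ * (φ x ^ 2 / (bdist Ω x) ^ 2) =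
      (η x) ^ 2 * u x * (μ / (bdist Ω x) ^ 2 * u x) := by simp only [hφdef]; ring
    rw [h4]
    nlinarith [h3]
  have hint := setIntegral_mono_on I3.integrableOn
    (((I2.add I5).add (I4.const_mul μ)).sub I1).integrableOn hΩo.measurableSet hpt
  have e1 : ∫ x in Ω, ((fun x => ‖gradient η x‖ ^ 2 * (u x) ^ 2)
      + (fun x => ∑ i, fderiv ℝ (V i) x (e i)) + (fun x => μ * (φ x ^ 2 / (bdist Ω x) ^ 2))
      - fun x => (η x) ^ 2 * (u x * ((u x) ^ p / (bdist Ω x) ^ s))) x =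
      (∫ x in Ω, ‖gradient η x‖ ^ 2 * (u x) ^ 2) + 0 + μ * (∫ x in Ω, φ x ^ 2 / (bdist Ω x) ^ 2)
      - ∫ x in Ω, (η x) ^ 2 * (u x * ((u x) ^ p / (bdist Ω x) ^ s)) := by
    rw [integral_sub' ((I2.add I5).add (I4.const_mul μ)).integrableOn I1.integrableOn,
      integral_add' (I2.add I5).integrableOn (I4.const_mul μ).integrableOn,
      integral_add' I2.integrableOn I5.integrableOn, hdiv, integral_const_mul]
  have hint' := hint.trans_eq e1
  linarith

lemma bdist_nonneg {N : ℕ} (Ω : Set (EuclideanSpace ℝ (Fin N))) (x : EuclideanSpace ℝ (Fin N)) :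
    0 ≤ bdist Ω x := Metric.infDist_nonneg

lemma deriv_zero_of_max {θ : ℝ → ℝ} (h : ∀ r, 0 ≤ θ r ∧ θ r ≤ 1) {r : ℝ} (hr : θ r = 1) :
    deriv θ r = 0 :=
  IsLocalMax.deriv_eq_zero (Filter.Eventually.of_forall fun y => by rw [hr]; exact (h y).2)

lemma deriv_zero_of_min {θ : ℝ → ℝ} (h : ∀ r, 0 ≤ θ r ∧ θ r ≤ 1) {r : ℝ} (hr : θ r = 0) :
    deriv θ r = 0 :=
  IsLocalMin.deriv_eq_zero (Filter.Eventually.of_forall fun y => by rw [hr]; exact (h y).1)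

lemma tsupport_comp_bdist {N : ℕ} (Ω : Set (EuclideanSpace ℝ (Fin N))) {g : ℝ → ℝ} {a : ℝ}
    (hg : ∀ r ≤ a, g r = 0) : tsupport (fun x => g (bdist Ω x)) ⊆ {x | a ≤ bdist Ω x} := by
  refine closure_minimal (fun x hx => ?_) (isClosed_le continuous_const (bdist_continuous Ω))
  by_contra h
  exact hx (hg _ (le_of_lt (not_le.1 h)))

lemma collar_isOpen {N : ℕ} {Ω : Set (EuclideanSpace ℝ (Fin N))} (hΩo : IsOpen Ω) (ρ : ℝ) :
    IsOpen (collar Ω ρ) :=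
  hΩo.inter (isOpen_lt (bdist_continuous Ω) continuous_const)

/-- Layer estimate. -/
lemma layer {N : ℕ} (Ω : Set (EuclideanSpace ℝ (Fin N)))
    (hΩo : IsOpen Ω) (hΩb : Bornology.IsBounded Ω) (ρ₀ : ℝ) (hρ₀ : GoodCollar Ω ρ₀) :
    ∃ C : ℝ, ∀ (θ : ℝ → ℝ) (a : ℝ), 0 < a → ContDiff ℝ 1 θ → (∀ r ≤ a, θ r = 0) →
      (∀ r, ρ₀ / 3 ≤ r → θ r = 1) → (∀ r, 0 ≤ θ r ∧ θ r ≤ 1) →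
      Integrable (fun x => deriv θ (bdist Ω x)) ∧ ∫ x in Ω, deriv θ (bdist Ω x) ≤ C := by
  obtain ⟨hρ, hδ2, hgrad, M, hM⟩ := hρ₀
  set χ : ℝ → ℝ := fun r => Real.smoothTransition (3 - 6 * r / ρ₀) with hχ
  have hχC : ContDiff ℝ 1 χ := by
    refine (Real.smoothTransition.contDiff (n := 1)).comp ?_
    exact contDiff_const.sub ((contDiff_const.mul contDiff_id).div_const _)
  have hχ1 : ∀ r ≤ ρ₀ / 3, χ r = 1 := fun r hr => by
    apply Real.smoothTransition.one_of_one_le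
    have : 6 * r / ρ₀ ≤ 2 := by rw [div_le_iff₀ hρ]; linarith
    linarith
  have hχ0 : ∀ r, ρ₀ / 2 ≤ r → χ r = 0 := fun r hr => by
    apply Real.smoothTransition.zero_of_nonpos
    have : 3 ≤ 6 * r / ρ₀ := by rw [le_div_iff₀ hρ]; linarith
    linarith
  have hχb : ∀ r, 0 ≤ χ r ∧ χ r ≤ 1 := fun r =>
    ⟨Real.smoothTransition.nonneg _, Real.smoothTransition.le_one _⟩
  obtain ⟨K, hK⟩ := (isCompact_Icc (a := (0:ℝ)) (b := ρ₀)).exists_bound_of_continuousOn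
    (hχC.continuous_deriv le_rfl).continuousOn
  have hK0 : 0 ≤ K := (norm_nonneg _).trans (hK 0 ⟨le_rfl, hρ.le⟩)
  refine ⟨(K + |M|) * volume.real Ω, fun θ a ha hθ hθ0 hθ1 hθb => ?_⟩
  have hθ' : Continuous (deriv θ) := hθ.continuous_deriv le_rfl
  have I1 : Integrable (fun x => deriv θ (bdist Ω x)) := by
    refine (hθ'.comp (bdist_continuous Ω)).integrable_of_hasCompactSupport ?_
    exact (isCompact_bdist_ge hΩb ha).of_isClosed_subset (isClosed_tsupport _)
      (tsupport_comp_bdist Ω fun r hr => deriv_zero_of_min hθb (hθ0 r hr))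
  refine ⟨I1, ?_⟩
  have hopen := collar_isOpen hΩo ρ₀
  let e : Fin N → EuclideanSpace ℝ (Fin N) := fun i => EuclideanSpace.single i 1
  set F : ℝ → ℝ := fun r => χ r * θ r with hF
  have hFC : ContDiff ℝ 1 F := hχC.mul hθ
  let V : Fin N → EuclideanSpace ℝ (Fin N) → ℝ := fun i x =>
    F (bdist Ω x) * fderiv ℝ (bdist Ω) x (e i)
  have hVs : ∀ i, tsupport (V i) ⊆ {x | a ≤ bdist Ω x ∧ bdist Ω x ≤ ρ₀ / 2} := by
    intro i
    refine closure_minimal (fun x hx => ?_)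
      ((isClosed_le continuous_const (bdist_continuous Ω)).inter
        (isClosed_le (bdist_continuous Ω) continuous_const))
    by_contra h
    apply hx
    have : F (bdist Ω x) = 0 := by
      by_cases h1 : a ≤ bdist Ω x
      · have h2 : ¬ bdist Ω x ≤ ρ₀ / 2 := fun h2 => h ⟨h1, h2⟩
        simp [hF, hχ0 _ (le_of_lt (not_le.1 h2))]
      · simp [hF, hθ0 _ (le_of_lt (not_le.1 h1))]
    simp [V, this]
  have hVcol : ∀ i, tsupport (V i) ⊆ collar Ω ρ₀ := fun i x hx => by
    obtain ⟨h1, h2⟩ := hVs i hx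
    exact ⟨mem_of_bdist_pos (lt_of_lt_of_le ha h1), by linarith⟩
  have hpd : ∀ i, ContDiffOn ℝ 1 (fun y => fderiv ℝ (bdist Ω) y (e i)) (collar Ω ρ₀) := fun i =>
    fderiv_pd_contDiffOn hopen hδ2 (e i)
  have hVC : ∀ i, ContDiff ℝ 1 (V i) := fun i => contDiff_of_tsupp fun x hx => by
    have hx' := hopen.mem_nhds (hVcol i hx)
    exact (hFC.contDiffAt.comp x ((hδ2.contDiffAt hx').of_le (by norm_num))).mul
      ((hpd i).contDiffAt hx')
  have hVc : ∀ i, HasCompactSupport (V i) := fun i =>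
    (isCompact_bdist_ge hΩb ha).of_isClosed_subset (isClosed_tsupport _)
      ((hVs i).trans fun x hx => hx.1)
  have IV : ∀ i, Integrable (fun x => fderiv ℝ (V i) x (e i)) := fun i =>
    (((hVC i).continuous_fderiv (by simp)).clm_apply continuous_const).integrable_of_hasCompactSupport
      ((hVc i).fderiv_apply ℝ (e i))
  have I5 : Integrable (fun x => ∑ i, fderiv ℝ (V i) x (e i)) := integrable_finsetSum _ fun i _ => IV i
  have hV0 : ∀ x ∉ collar Ω ρ₀, ∑ i, fderiv ℝ (V i) x (e i) = 0 := by
    intro x hx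
    refine Finset.sum_eq_zero fun i _ => ?_
    have : fderiv ℝ (V i) x = 0 := image_eq_zero_of_notMem_tsupport
      (fun h => hx (hVcol i (tsupport_fderiv_subset ℝ h)))
    simp [this]
  have hdiv : ∫ x in Ω, ∑ i, fderiv ℝ (V i) x (e i) = 0 := by
    rw [setIntegral_eq_integral_of_forall_compl_eq_zero, integral_finsetSum _ fun i _ => IV i]
    · exact Finset.sum_eq_zero fun i _ => integral_fderiv_zero (V i) (hVC i) (hVc i) (e i)
    · intro x hx
      exact hV0 x fun h => hx h.1
  have hvol : volume Ω ≠ ⊤ := hΩb.measure_lt_top.ne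
  have I6 : IntegrableOn (fun _ : EuclideanSpace ℝ (Fin N) => K + |M|) Ω :=
    integrableOn_const hvol
  have hpt : ∀ x ∈ Ω, deriv θ (bdist Ω x) ≤
      ((fun x => ∑ i, fderiv ℝ (V i) x (e i)) +
        (fun _ => K + |M|) : EuclideanSpace ℝ (Fin N) → ℝ) x := by
    intro x hx
    simp only [Pi.add_apply]
    rcases lt_or_ge (bdist Ω x) ρ₀ with h | h
    · have hxc : x ∈ collar Ω ρ₀ := ⟨hx, h⟩
      have hxn := hopen.mem_nhds hxc
      have dδ : HasFDerivAt (bdist Ω) (fderiv ℝ (bdist Ω) x) x :=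
        ((hδ2.contDiffAt hxn).differentiableAt (by norm_num)).hasFDerivAt
      have dF : HasDerivAt F (deriv χ (bdist Ω x) * θ (bdist Ω x)
          + χ (bdist Ω x) * deriv θ (bdist Ω x)) (bdist Ω x) :=
        ((hχC.differentiable (by simp)).differentiableAt.hasDerivAt).mul
          ((hθ.differentiable (by simp)).differentiableAt.hasDerivAt)
      have dV : ∀ i, fderiv ℝ (V i) x (e i) = F (bdist Ω x) *
          fderiv ℝ (fun y => fderiv ℝ (bdist Ω) y (e i)) x (e i) +
          (deriv χ (bdist Ω x) * θ (bdist Ω x) + χ (bdist Ω x) * deriv θ (bdist Ω x)) *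
          (fderiv ℝ (bdist Ω) x (e i)) ^ 2 := by
        intro i
        have d2 : HasFDerivAt (fun y => fderiv ℝ (bdist Ω) y (e i))
            (fderiv ℝ (fun y => fderiv ℝ (bdist Ω) y (e i)) x) x :=
          (((hpd i).contDiffAt hxn).differentiableAt (by norm_num)).hasFDerivAt
        have := ((dF.comp_hasFDerivAt x dδ).mul d2).fderiv
        rw [show fderiv ℝ (V i) x = _ from this]
        simp
        ring
      have hsum : ∑ i, fderiv ℝ (V i) x (e i) = F (bdist Ω x) * lap (bdist Ω) x +
          (deriv χ (bdist Ω x) * θ (bdist Ω x) + χ (bdist Ω x) * deriv θ (bdist Ω x)) := by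
        have hg : ∑ i, (fderiv ℝ (bdist Ω) x (e i)) ^ 2 = 1 := by
          have := norm_gradient_sq (bdist Ω) x
          rw [hgrad x hxc] at this
          rw [← this]; norm_num
        rw [Finset.sum_congr rfl fun i _ => dV i, Finset.sum_add_distrib, ← Finset.mul_sum,
          ← Finset.mul_sum, hg, mul_one]
        rfl
      rw [hsum]
      have h1 : χ (bdist Ω x) * deriv θ (bdist Ω x) = deriv θ (bdist Ω x) := by
        rcases le_or_gt (bdist Ω x) (ρ₀ / 3) with h' | h'
        · rw [hχ1 _ h', one_mul]
        · rw [deriv_zero_of_max hθb (hθ1 _ h'.le), mul_zero]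
      rw [h1]
      have h2 : |F (bdist Ω x) * lap (bdist Ω) x| ≤ |M| := by
        rw [abs_mul]
        have hF1 : |F (bdist Ω x)| ≤ 1 := by
          have hc := hχb (bdist Ω x)
          have ht := hθb (bdist Ω x)
          rw [abs_of_nonneg (mul_nonneg hc.1 ht.1)]
          exact mul_le_one₀ hc.2 ht.1 ht.2
        calc _ ≤ 1 * |M| := mul_le_mul hF1 ((hM x hxc).trans (le_abs_self M)) (abs_nonneg _)
              zero_le_one
          _ = _ := one_mul _
      have h3 : |deriv χ (bdist Ω x) * θ (bdist Ω x)| ≤ K := by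
        rw [abs_mul]
        have ht := hθb (bdist Ω x)
        calc _ ≤ K * 1 := mul_le_mul (hK _ ⟨bdist_nonneg Ω x, h.le⟩)
              (by rw [abs_of_nonneg ht.1]; exact ht.2) (abs_nonneg _) hK0
          _ = _ := mul_one _
      have h2' := (abs_le.1 h2).1
      have h3' := (abs_le.1 h3).1
      linarith
    · rw [hV0 x (fun hc => absurd hc.2 (not_lt.2 h)),
        deriv_zero_of_max hθb (hθ1 _ (by linarith))]
      positivity
  have hint := setIntegral_mono_on I1.integrableOn (I5.integrableOn.add I6) hΩo.measurableSet hpt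
  rw [integral_add' I5.integrableOn I6, hdiv, setIntegral_const, smul_eq_mul] at hint
  linarith

/-- (No nontrivial `S`-subsolutions below the Hardy constant.) Let
`μ ≤ 1/4`, `p > 1`, `s ∈ ℝ`, and assume the global Hardy inequality with constant `μ`
holds on `Ω`. If `u` is a sub-solution of `(*)` on all of `Ω` with
`lim_{δ(x)→0} u(x)/(δ(x)^{1/2}·(log(1/δ(x)))^{1/2}) = 0`, then `u ≡ 0` on `Ω`. -/
theorem stmt19 {N : ℕ} (hN : 2 ≤ N) (Ω : Set (EuclideanSpace ℝ (Fin N)))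
    (hΩo : IsOpen Ω) (hΩne : Ω.Nonempty) (hΩb : Bornology.IsBounded Ω)
    (ρ₀ : ℝ) (hρ₀ : GoodCollar Ω ρ₀)
    (μ s p : ℝ) (hμ : μ ≤ 1 / 4) (hp : 1 < p)
    (hHardy : ∀ φ : EuclideanSpace ℝ (Fin N) → ℝ, ContDiff ℝ (⊤ : ℕ∞) φ →
      HasCompactSupport φ → tsupport φ ⊆ Ω →
      μ * ∫ x in Ω, (φ x) ^ 2 / (bdist Ω x) ^ 2 ≤ ∫ x in Ω, ‖gradient φ x‖ ^ 2)
    (u : EuclideanSpace ℝ (Fin N) → ℝ) (hu : SubSol Ω μ s p Ω u)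
    (hS : ∀ ε : ℝ, 0 < ε → ∃ ρ', 0 < ρ' ∧ ρ' < 1 ∧
      ∀ x ∈ collar Ω ρ',
        u x / (bdist Ω x ^ (1 / 2 : ℝ) * Real.log (1 / bdist Ω x) ^ (1 / 2 : ℝ)) ≤ ε) :
    ∀ x ∈ Ω, u x = 0 := by
  intro x₀ hx₀
  by_contra hne
  have hδpos : ∀ x ∈ Ω, 0 < bdist Ω x := fun x hx => bdist_pos hN hΩo hΩb hx
  have hu0 := hu.2.1
  have hupos : 0 < u x₀ := lt_of_le_of_ne (hu0 x₀ hx₀) (Ne.symm hne)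
  have hδ0 := hδpos x₀ hx₀
  obtain ⟨hρ0, hδ2, hgrad, -⟩ := id hρ₀
  obtain ⟨C, hC⟩ := layer Ω hΩo hΩb ρ₀ hρ₀
  obtain ⟨ρ', hρ', hρ'1, hS1⟩ := hS 1 one_pos
  -- lower bound for `Q` near `x₀`
  set Q : EuclideanSpace ℝ (Fin N) → ℝ := fun x => u x * ((u x) ^ p / (bdist Ω x) ^ s) with hQ
  have huc : ContinuousOn u Ω := hu.1.continuousOn
  have hQc : ContinuousOn Q Ω :=
    huc.mul ((huc.rpow_const fun x _ => Or.inr (by linarith)).div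
      ((bdist_continuous Ω).continuousOn.rpow_const fun x hx => Or.inl (hδpos x hx).ne')
      fun x hx => (Real.rpow_pos_of_pos (hδpos x hx) s).ne')
  have hQ0 : ∀ x ∈ Ω, 0 ≤ Q x := fun x hx =>
    mul_nonneg (hu0 x hx) (div_nonneg (Real.rpow_nonneg (hu0 x hx) _)
      (Real.rpow_nonneg (hδpos x hx).le _))
  have hQx : 0 < Q x₀ :=
    mul_pos hupos (div_pos (Real.rpow_pos_of_pos hupos _) (Real.rpow_pos_of_pos hδ0 _))
  have hnear : {x | Q x₀ / 2 < Q x} ∩ {x | bdist Ω x₀ / 2 < bdist Ω x} ∈ nhds x₀ := by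
    refine Filter.inter_mem ?_ ?_
    · exact (hQc.continuousAt (hΩo.mem_nhds hx₀)).eventually (lt_mem_nhds (half_lt_self hQx))
    · exact (bdist_continuous Ω).continuousAt.eventually (lt_mem_nhds (half_lt_self hδ0))
  obtain ⟨r, hr, hball⟩ := Metric.mem_nhds_iff.1 hnear
  have hballΩ : ball x₀ r ⊆ Ω := fun x hx =>
    mem_of_bdist_pos (lt_trans (half_pos hδ0) (hball hx).2)
  set c : ℝ := volume.real (ball x₀ r) * (Q x₀ / 2) with hc
  have hcpos : 0 < c := by
    refine mul_pos ?_ (half_pos hQx)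
    exact ENNReal.toReal_pos (measure_ball_pos volume x₀ hr).ne' measure_ball_lt_top.ne
  -- the key estimate
  have key : ∀ κ : ℝ, 0 < κ → c ≤ κ * C := by
    intro κ hκ
    set ρ := min (ρ₀ / 3) (min (ρ' / 2) (bdist Ω x₀ / 2)) with hρ
    have hρpos : 0 < ρ := lt_min (by positivity) (lt_min (by positivity) (by positivity))
    have hρ1 : ρ ≤ ρ₀ / 3 := min_le_left _ _
    have hρ2 : ρ ≤ ρ' / 2 := (min_le_right _ _).trans (min_le_left _ _)
    have hρ3 : ρ ≤ bdist Ω x₀ / 2 := (min_le_right _ _).trans (min_le_right _ _)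
    obtain ⟨θ, a, ha, hθC, hθ0, hθ1, hθb, hθd, hθk⟩ := cutoff_exists ρ κ hρpos hκ
    obtain ⟨I1, hI1⟩ := hC θ a ha hθC hθ0 (fun r hr => hθ1 r (hρ1.trans hr)) hθb
    set η : EuclideanSpace ℝ (Fin N) → ℝ := fun x => θ (bdist Ω x) with hη
    have hηs : tsupport η ⊆ {x | a ≤ bdist Ω x} := tsupport_comp_bdist Ω hθ0
    have hηΩ : tsupport η ⊆ Ω := fun x hx => mem_of_bdist_pos (lt_of_lt_of_le ha (hηs hx))
    have hηc : HasCompactSupport η :=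
      (isCompact_bdist_ge hΩb ha).of_isClosed_subset (isClosed_tsupport _) hηs
    have hopen := collar_isOpen hΩo ρ₀
    have hη1 : ∀ x, ρ < bdist Ω x → η =ᶠ[nhds x] fun _ => 1 := by
      intro x hx
      filter_upwards [(bdist_continuous Ω).continuousAt.eventually (lt_mem_nhds hx)] with y hy
      exact hθ1 _ hy.le
    have hηC : ContDiff ℝ 1 η := contDiff_of_tsupp fun x hx => by
      rcases lt_or_ge (bdist Ω x) ρ₀ with h | h
      · exact hθC.contDiffAt.comp x ((hδ2.contDiffAt (hopen.mem_nhds ⟨hηΩ hx, h⟩)).of_le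
          (by norm_num))
      · exact contDiffAt_const.congr_of_eventuallyEq (hη1 x (by linarith))
    obtain ⟨J1, J2, hE⟩ := energy hN Ω hΩo hΩb μ s p hp hHardy u hu η hηC hηc hηΩ
    have hpt : ∀ x ∈ Ω, ‖gradient η x‖ ^ 2 * (u x) ^ 2 ≤ κ * deriv θ (bdist Ω x) := by
      intro x hx
      rcases lt_or_ge (bdist Ω x) ρ₀ with h | h
      · have hxc : x ∈ collar Ω ρ₀ := ⟨hx, h⟩
        have dδ : HasFDerivAt (bdist Ω) (fderiv ℝ (bdist Ω) x) x :=
          ((hδ2.contDiffAt (hopen.mem_nhds hxc)).differentiableAt (by norm_num)).hasFDerivAt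
        have dη : fderiv ℝ η x = deriv θ (bdist Ω x) • fderiv ℝ (bdist Ω) x :=
          (((hθC.differentiable (by simp)).differentiableAt.hasDerivAt).comp_hasFDerivAt
            x dδ).fderiv
        have hn : ‖gradient η x‖ ^ 2 = deriv θ (bdist Ω x) ^ 2 := by
          have hg := hgrad x hxc
          rw [norm_gradient_eq] at hg ⊢
          rw [dη, norm_smul, hg, mul_one, Real.norm_eq_abs, sq_abs]
        rw [hn]
        rcases lt_or_ge (bdist Ω x) ρ with h' | h'
        · have hd := hδpos x hx
          have hd1 : bdist Ω x < 1 := by linarith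
          have hL : 0 < Real.log (1 / bdist Ω x) :=
            Real.log_pos (by rw [lt_div_iff₀ hd]; linarith)
          have hb := hS1 x ⟨hx, by linarith⟩
          have hA : 0 < bdist Ω x ^ (1 / 2 : ℝ) := Real.rpow_pos_of_pos hd _
          have hB : 0 < Real.log (1 / bdist Ω x) ^ (1 / 2 : ℝ) := Real.rpow_pos_of_pos hL _
          rw [div_le_iff₀ (mul_pos hA hB), one_mul] at hb
          have hsq : (u x) ^ 2 ≤ bdist Ω x * Real.log (1 / bdist Ω x) := by
            calc (u x) ^ 2 ≤ (bdist Ω x ^ (1 / 2 : ℝ) *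
                  Real.log (1 / bdist Ω x) ^ (1 / 2 : ℝ)) ^ 2 := by
                    gcongr
                    exact hu0 x hx
              _ = _ := by
                rw [← Real.sqrt_eq_rpow, ← Real.sqrt_eq_rpow, mul_pow, Real.sq_sqrt hd.le,
                  Real.sq_sqrt hL.le]
          calc _ ≤ deriv θ (bdist Ω x) ^ 2 * (bdist Ω x * Real.log (1 / bdist Ω x)) := by gcongr
            _ = bdist Ω x * Real.log (1 / bdist Ω x) * deriv θ (bdist Ω x) ^ 2 := by ring
            _ ≤ _ := hθk _ hd hd1
        · rw [deriv_zero_of_max hθb (hθ1 _ h')]; simp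
      · have : fderiv ℝ η x = 0 := by
          rw [(hη1 x (by linarith)).fderiv_eq]; simp
        rw [norm_gradient_eq, this, norm_zero]
        have := mul_nonneg hκ.le (hθd (bdist Ω x))
        simpa using this
    have h1 : ∫ x in Ω, ‖gradient η x‖ ^ 2 * (u x) ^ 2 ≤ κ * C := by
      refine (setIntegral_mono_on J2.integrableOn (I1.const_mul κ).integrableOn
        hΩo.measurableSet hpt).trans ?_
      rw [integral_const_mul]
      exact mul_le_mul_of_nonneg_left hI1 hκ.le
    have h2 : c ≤ ∫ x in ball x₀ r, (η x) ^ 2 * Q x := by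
      have := setIntegral_mono_on (f := fun _ => Q x₀ / 2) (μ := volume)
        (integrableOn_const measure_ball_lt_top.ne) J1.integrableOn
        (measurableSet_ball (x := x₀) (ε := r)) (fun x hx => by
          have h := hball hx
          have h3 : η x = 1 := hθ1 _ (hρ3.trans h.2.le)
          rw [h3, one_pow, one_mul]
          exact h.1.le)
      rwa [setIntegral_const, smul_eq_mul] at this
    have h3 : ∫ x in ball x₀ r, (η x) ^ 2 * Q x ≤ ∫ x in Ω, (η x) ^ 2 * Q x := by
      refine setIntegral_mono_set J1.integrableOn ?_ hballΩ.eventuallyLE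
      filter_upwards [ae_restrict_mem hΩo.measurableSet] with x hx
      exact mul_nonneg (sq_nonneg _) (hQ0 x hx)
    exact h2.trans (h3.trans (hE.trans h1))
  have hk := key (c / (2 * (|C| + 1))) (by positivity)
  have h1 : c / (2 * (|C| + 1)) * C ≤ c / (2 * (|C| + 1)) * (|C| + 1) :=
    mul_le_mul_of_nonneg_left (by linarith [le_abs_self C]) (by positivity)
  have h2 : c / (2 * (|C| + 1)) * (|C| + 1) = c / 2 := by
    have : |C| + 1 ≠ 0 := by positivity
    field_simp
  linarith
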